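/- Let μ ≥ 0 and η > η̄. Then the optimal value function u_{η,μ} is continuously differentiable on ℝ^p × ℝ^q, and for every (β̃,γ̃) ∈ ℝ^p × ℝ^q its gradient is given by ∇u_{η,μ}(β̃,γ̃) = η·(β̃ − β̂, γ̃ − γ̂), where (β̂,γ̂) = S_{η,μ}(β̃,γ̃) is the unique minimizer of (β,γ) ↦ L_{η,μ}((β,γ),(β̃,γ̃)). -/

import Mathlib

open Matrix Real Filter Topology Bornology
open scoped Pointwise

noncomputable section

abbrev Vec (k : ℕ) : Type := Fin k → ℝ

/-- Euclidean norm of a vector. -/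
def eNorm {ι : Type*} [Fintype ι] (x : ι → ℝ) : ℝ := Real.sqrt (∑ j, (x j) ^ 2)

/-- Squared Euclidean norm of a pair of vectors. -/
def sqnorm2 {p q : ℕ} (w : Vec p × Vec q) : ℝ :=
  (∑ j, (w.1 j) ^ 2) + ∑ j, (w.2 j) ^ 2

/-- ℓ²→ℓ² operator norm of a matrix (its largest singular value). -/
def opNorm {ι κ : Type*} [Fintype ι] [Fintype κ] (M : Matrix ι κ ℝ) : ℝ :=
  sInf {c : ℝ | 0 ≤ c ∧ ∀ x : κ → ℝ, eNorm (M.mulVec x) ≤ c * eNorm x}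

/-- Smallest eigenvalue of a symmetric matrix, via Rayleigh quotients. -/
def minEig {ι : Type*} [Fintype ι] (M : Matrix ι ι ℝ) : ℝ :=
  sInf {r : ℝ | ∃ x : ι → ℝ, eNorm x = 1 ∧ r = x ⬝ᵥ M.mulVec x}

/-- Largest eigenvalue of a symmetric matrix, via Rayleigh quotients. -/
def maxEig {ι : Type*} [Fintype ι] (M : Matrix ι ι ℝ) : ℝ :=
  sSup {r : ℝ | ∃ x : ι → ℝ, eNorm x = 1 ∧ r = x ⬝ᵥ M.mulVec x}

/-- The log-barrier (perspective of the negative log). -/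
def phiBar (μ : ℝ) {q : ℕ} (γ : Vec q) : EReal :=
  if μ = 0 then (if ∀ j, 0 ≤ γ j then (0 : EReal) else ⊤)
  else if 0 < μ then
    (if ∀ j, 0 < γ j then (((-μ) * ∑ j, Real.log (γ j / μ) : ℝ) : EReal) else ⊤)
  else ⊤

/-- The coupling function κ_η. -/
def kappaFun (η : ℝ) {p q : ℕ} (w : Vec p × Vec q) : ℝ := η / 2 * sqnorm2 w

/-- 1-coercivity: liminf of F(w)/‖w‖ as ‖w‖ → ∞ is positive. -/
def OneCoercive {p q : ℕ} (R : Vec p × Vec q → EReal) : Prop :=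
  ∃ c : ℝ, 0 < c ∧ ∃ r : ℝ, ∀ w : Vec p × Vec q,
    r ≤ Real.sqrt (sqnorm2 w) → ((c * Real.sqrt (sqnorm2 w) : ℝ) : EReal) ≤ R w

/-- Data of a linear mixed-effects model. -/
structure LMEData (m p q : ℕ) where
  n : Fin m → ℕ
  X : ∀ i, Matrix (Fin (n i)) (Fin p) ℝ
  Z : ∀ i, Matrix (Fin (n i)) (Fin q) ℝ
  y : ∀ i, Fin (n i) → ℝ
  lam : ∀ i, Matrix (Fin (n i)) (Fin (n i)) ℝ

namespace LMEData

variable {m p q : ℕ}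

/-- Ω_i(Γ) = Z_i Γ Z_iᵀ + Λ_i. -/
def Omega (D : LMEData m p q) (Γ : Matrix (Fin q) (Fin q) ℝ) (i : Fin m) :
    Matrix (Fin (D.n i)) (Fin (D.n i)) ℝ :=
  D.Z i * Γ * (D.Z i)ᵀ + D.lam i

/-- The marginal negative log-likelihood L_ML(β, Γ). -/
def LML (D : LMEData m p q) (β : Vec p) (Γ : Matrix (Fin q) (Fin q) ℝ) : ℝ :=
  ∑ i, ((1 : ℝ) / 2 * ((D.y i - D.X i *ᵥ β) ⬝ᵥ ((D.Omega Γ i)⁻¹ *ᵥ (D.y i - D.X i *ᵥ β)))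
    + (1 : ℝ) / 2 * Real.log (D.Omega Γ i).det)

/-- L(β, γ) = L_ML(β, Diag γ). -/
def L (D : LMEData m p q) (β : Vec p) (γ : Vec q) : ℝ := D.LML β (Matrix.diagonal γ)

/-- ν = max_i (1/2) μ_min(Λ_i)^{-2} σ_max(Z_i)^4. -/
def nu (D : LMEData m p q) : ℝ :=
  ⨆ i : Fin m, (1 : ℝ) / 2 * ((minEig (D.lam i)) ^ 2)⁻¹ * (opNorm (D.Z i)) ^ 4

/-- η̄ = ν m. -/
def etabar (D : LMEData m p q) : ℝ := D.nu * m

/-- L_{η,μ}((β,γ),(β̃,γ̃)) = L(β,γ) + φ_μ(γ) + κ_η(β−β̃,γ−γ̃). -/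
def Lrelax (D : LMEData m p q) (η μ : ℝ) (x w : Vec p × Vec q) : EReal :=
  ((D.L x.1 x.2 + kappaFun η (x - w) : ℝ) : EReal) + phiBar μ x.2

/-- The optimal value function u_{η,μ} (with extended-real values). -/
def uval (D : LMEData m p q) (η μ : ℝ) (w : Vec p × Vec q) : EReal :=
  ⨅ x : Vec p × Vec q, D.Lrelax η μ x w

/-- The (real-valued) optimal value function u_{η,μ}. -/
def ufun (D : LMEData m p q) (η μ : ℝ) (w : Vec p × Vec q) : ℝ := (D.uval η μ w).toReal

/-- Partial gradient ∇_β L. -/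
def gradB (D : LMEData m p q) (β : Vec p) (γ : Vec q) : Vec p :=
  fun j => fderiv ℝ (fun b => D.L b γ) β (Pi.single j 1)

/-- Partial gradient ∇_γ L. -/
def gradG (D : LMEData m p q) (β : Vec p) (γ : Vec q) : Vec q :=
  fun j => fderiv ℝ (fun g => D.L β g) γ (Pi.single j 1)

/-- The map G_{η,μ}. -/
def Gmap (D : LMEData m p q) (η μ : ℝ) (x : Vec p × Vec q × Vec q) (w : Vec p × Vec q) :
    Vec p × Vec q × Vec q :=
  (D.gradB x.1 x.2.1 + η • (x.1 - w.1),
   D.gradG x.1 x.2.1 + η • (x.2.1 - w.2) - x.2.2,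
   fun j => x.2.2 j * x.2.1 j - μ)

/-- Second-derivative block ∇²_{ββ} L. -/
def hessBB (D : LMEData m p q) (β : Vec p) (γ : Vec q) : Matrix (Fin p) (Fin p) ℝ :=
  Matrix.of fun j k => fderiv ℝ (fun b => D.gradB b γ j) β (Pi.single k 1)

/-- Second-derivative block ∇²_{γγ} L. -/
def hessGG (D : LMEData m p q) (β : Vec p) (γ : Vec q) : Matrix (Fin q) (Fin q) ℝ :=
  Matrix.of fun j k => fderiv ℝ (fun g => D.gradG β g j) γ (Pi.single k 1)

/-- Second-derivative block ∇²_{γβ} L (the p×q cross block). -/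
def hessGB (D : LMEData m p q) (β : Vec p) (γ : Vec q) : Matrix (Fin p) (Fin q) ℝ :=
  Matrix.of fun j k => fderiv ℝ (fun g => D.gradB β g j) γ (Pi.single k 1)

/-- Second-derivative block ∇²_{βγ} L (the q×p cross block). -/
def hessBG (D : LMEData m p q) (β : Vec p) (γ : Vec q) : Matrix (Fin q) (Fin p) ℝ :=
  Matrix.of fun j k => fderiv ℝ (fun b => D.gradG b γ j) β (Pi.single k 1)

end LMEData

/-- f(r, M) = (1/2)(rᵀM⁻¹r + ln det M). -/
def fRM {n : ℕ} (r : Vec n) (M : Matrix (Fin n) (Fin n) ℝ) : ℝ :=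
  (1 : ℝ) / 2 * (r ⬝ᵥ (M⁻¹ *ᵥ r) + Real.log M.det)

theorem aux_psd_factor {n : ℕ} {A : Matrix (Fin n) (Fin n) ℝ} (hA : A.PosSemidef) :
    ∃ C : Matrix (Fin n) (Fin n) ℝ, A = Cᵀ * C := by
  open scoped MatrixOrder in
  obtain ⟨B, hB⟩ := CStarAlgebra.nonneg_iff_eq_star_mul_self.mp hA.nonneg
  exact ⟨B, by rw [hB, Matrix.star_eq_conjTranspose, Matrix.conjTranspose_eq_transpose_of_trivial]⟩

theorem aux_logdet_le_trace {n : ℕ} {K : Matrix (Fin n) (Fin n) ℝ} (hK : K.PosDef) :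
    Real.log K.det ≤ K.trace - n := by
  have h1 := hK.isHermitian.det_eq_prod_eigenvalues
  have h2 := hK.isHermitian.trace_eq_sum_eigenvalues
  simp only [RCLike.ofReal_real_eq_id, id_eq] at h1 h2
  rw [h1, h2, Real.log_prod (fun i _ => (hK.eigenvalues_pos i).ne')]
  have : ∑ i, Real.log (hK.isHermitian.eigenvalues i)
      ≤ ∑ i, (hK.isHermitian.eigenvalues i - 1) :=
    Finset.sum_le_sum fun i _ => Real.log_le_sub_one_of_pos (hK.eigenvalues_pos i)
  simpa using this

theorem aux_logdet {n : ℕ} {A B : Matrix (Fin n) (Fin n) ℝ} (hA : A.PosDef) (hB : B.PosDef) :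
    Real.log B.det ≤ Real.log A.det + (A⁻¹ * (B - A)).trace := by
  obtain ⟨C, hC⟩ := aux_psd_factor hA.inv.posSemidef
  have hdetA := hA.det_pos
  have hdetB := hB.det_pos
  have hCd : C.det * C.det = A.det⁻¹ := by
    have := congrArg Matrix.det hC
    rw [Matrix.det_mul, Matrix.det_transpose, Matrix.det_nonsing_inv, Ring.inverse_eq_inv'] at this
    exact this.symm
  have hC0 : C.det ≠ 0 := by
    intro h; rw [h] at hCd; simp at hCd; exact hdetA.ne' hCd.symm
  have hK : (C * B * Cᵀ).PosDef := by
    have hps : (C * B * Cᵀ).PosSemidef := by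
      have := hB.posSemidef.mul_mul_conjTranspose_same C
      rwa [Matrix.conjTranspose_eq_transpose_of_trivial] at this
    rw [hps.posDef_iff_det_ne_zero]
    simp [Matrix.det_mul, hC0, hdetB.ne']
  have h := aux_logdet_le_trace hK
  have hd : (C * B * Cᵀ).det = A.det⁻¹ * B.det := by
    rw [Matrix.det_mul, Matrix.det_mul, Matrix.det_transpose, ← hCd]; ring
  have ht : (C * B * Cᵀ).trace = (A⁻¹ * B).trace := by
    rw [Matrix.mul_assoc, Matrix.trace_mul_comm, Matrix.mul_assoc, ← hC, Matrix.trace_mul_comm]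
  rw [hd, ht, Real.log_mul (inv_ne_zero hdetA.ne') hdetB.ne', Real.log_inv] at h
  rw [Matrix.mul_sub, Matrix.nonsing_inv_mul _ (isUnit_iff_ne_zero.2 hdetA.ne'), Matrix.trace_sub,
    Matrix.trace_one, Fintype.card_fin]
  linarith

theorem aux_symm {n : ℕ} {A : Matrix (Fin n) (Fin n) ℝ} (hA : A.PosSemidef) (x y : Fin n → ℝ) :
    x ⬝ᵥ (A *ᵥ y) = y ⬝ᵥ (A *ᵥ x) := by
  have : Aᵀ = A := by
    have := hA.isHermitian
    rwa [Matrix.IsHermitian, Matrix.conjTranspose_eq_transpose_of_trivial] at this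
  rw [Matrix.dotProduct_mulVec, ← Matrix.mulVec_transpose, this, dotProduct_comm]

theorem aux_inv_mulVec {n : ℕ} {A : Matrix (Fin n) (Fin n) ℝ} (hA : A.PosDef) (x : Fin n → ℝ) :
    A *ᵥ (A⁻¹ *ᵥ x) = x := by
  rw [Matrix.mulVec_mulVec, Matrix.mul_nonsing_inv _ (isUnit_iff_ne_zero.2 hA.det_pos.ne'),
    Matrix.one_mulVec]

/-- variational lower bound -/
theorem aux_var {n : ℕ} {A : Matrix (Fin n) (Fin n) ℝ} (hA : A.PosDef) (r v : Fin n → ℝ) :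
    2 * (v ⬝ᵥ r) - v ⬝ᵥ (A *ᵥ v) ≤ r ⬝ᵥ (A⁻¹ *ᵥ r) := by
  set z := A⁻¹ *ᵥ r with hz
  have hAz : A *ᵥ z = r := aux_inv_mulVec hA r
  have h := hA.posSemidef.dotProduct_mulVec_nonneg (v - z)
  have hs := aux_symm hA.posSemidef v z
  simp only [star_trivial, Matrix.mulVec_sub, sub_dotProduct, dotProduct_sub] at h
  rw [hAz] at h hs
  rw [dotProduct_comm r z]
  linarith

theorem aux_quad_convex {n : ℕ} {A B : Matrix (Fin n) (Fin n) ℝ} (hA : A.PosDef) (hB : B.PosDef)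
    (r s : Fin n → ℝ) (a b : ℝ) (ha : 0 ≤ a) (hb : 0 ≤ b)
    (hM : (a • A + b • B).PosDef) :
    (a • r + b • s) ⬝ᵥ ((a • A + b • B)⁻¹ *ᵥ (a • r + b • s))
      ≤ a * (r ⬝ᵥ (A⁻¹ *ᵥ r)) + b * (s ⬝ᵥ (B⁻¹ *ᵥ s)) := by
  set v := (a • A + b • B)⁻¹ *ᵥ (a • r + b • s) with hv
  have hMv : (a • A + b • B) *ᵥ v = a • r + b • s := aux_inv_mulVec hM _
  have h1 := mul_le_mul_of_nonneg_left (aux_var hA r v) ha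
  have h2 := mul_le_mul_of_nonneg_left (aux_var hB s v) hb
  have h3 : v ⬝ᵥ ((a • A + b • B) *ᵥ v) = a * (v ⬝ᵥ (A *ᵥ v)) + b * (v ⬝ᵥ (B *ᵥ v)) := by
    simp [Matrix.add_mulVec, Matrix.smul_mulVec, dotProduct_add]
  rw [hMv] at h3
  have h4 : v ⬝ᵥ (a • r + b • s) = a * (v ⬝ᵥ r) + b * (v ⬝ᵥ s) := by
    simp [dotProduct_add]
  rw [dotProduct_comm]
  linarith

theorem aux_trace_nonneg {n : ℕ} {P Q : Matrix (Fin n) (Fin n) ℝ} (hP : P.PosSemidef)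
    (hQ : Q.PosSemidef) : 0 ≤ (P * Q).trace := by
  obtain ⟨C, hC⟩ := aux_psd_factor hQ
  have := (hP.mul_mul_conjTranspose_same C).trace_nonneg
  rw [Matrix.conjTranspose_eq_transpose_of_trivial, Matrix.trace_mul_comm, ← Matrix.mul_assoc,
    ← hC, Matrix.trace_mul_comm] at this
  exact this

/-- `tr(P D Q D) ≤ s² |δ|²` -/
theorem aux_trace_bound {n : ℕ} {P Q : Matrix (Fin n) (Fin n) ℝ} (s : ℝ) (hs : 0 ≤ s)
    (hP : (s • (1 : Matrix (Fin n) (Fin n) ℝ) - P).PosSemidef) (hQ0 : Q.PosSemidef)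
    (hQ : (s • (1 : Matrix (Fin n) (Fin n) ℝ) - Q).PosSemidef) (δ : Fin n → ℝ) :
    (P * (diagonal δ * Q * diagonal δ)).trace ≤ s ^ 2 * ∑ j, δ j ^ 2 := by
  have hD : (diagonal δ * Q * diagonal δ).PosSemidef := by
    have := hQ0.mul_mul_conjTranspose_same (diagonal δ)
    rwa [Matrix.conjTranspose_eq_transpose_of_trivial, Matrix.diagonal_transpose] at this
  have h := aux_trace_nonneg hP hD
  rw [Matrix.sub_mul, Matrix.trace_sub, Matrix.smul_mul, Matrix.one_mul, Matrix.trace_smul,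
    smul_eq_mul] at h
  have h2 : (diagonal δ * Q * diagonal δ).trace ≤ s * ∑ j, δ j ^ 2 := by
    rw [Matrix.trace, Finset.mul_sum]
    refine Finset.sum_le_sum fun j _ => ?_
    have := hQ.diag_nonneg (i := j)
    simp at this
    simp only [Matrix.diag_apply, Matrix.mul_diagonal, Matrix.diagonal_mul]
    nlinarith [sq_nonneg (δ j)]
  nlinarith

theorem aux_resolvent {n : ℕ} {A B : Matrix (Fin n) (Fin n) ℝ} (hA : A.PosDef) (hB : B.PosDef) :
    A⁻¹ - B⁻¹ = A⁻¹ * (B - A) * B⁻¹ := by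
  rw [Matrix.mul_sub, Matrix.sub_mul, Matrix.nonsing_inv_mul _ (isUnit_iff_ne_zero.2 hA.det_pos.ne'),
    Matrix.mul_assoc, Matrix.mul_nonsing_inv _ (isUnit_iff_ne_zero.2 hB.det_pos.ne'), Matrix.mul_one,
    Matrix.one_mul]

theorem aux_eNorm_sq {ι : Type*} [Fintype ι] (x : ι → ℝ) : eNorm x ^ 2 = x ⬝ᵥ x := by
  rw [eNorm, Real.sq_sqrt (by positivity)]
  simp [dotProduct, sq]

theorem aux_eNorm_nonneg {ι : Type*} [Fintype ι] (x : ι → ℝ) : 0 ≤ eNorm x := Real.sqrt_nonneg _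

theorem aux_eNorm_smul {ι : Type*} [Fintype ι] (c : ℝ) (hc : 0 ≤ c) (x : ι → ℝ) :
    eNorm (c • x) = c * eNorm x := by
  rw [← sq_eq_sq₀ (aux_eNorm_nonneg _) (mul_nonneg hc (aux_eNorm_nonneg _)), mul_pow,
    aux_eNorm_sq, aux_eNorm_sq]
  simp; ring

theorem aux_eNorm_eq_zero {ι : Type*} [Fintype ι] (x : ι → ℝ) (h : eNorm x = 0) : x = 0 := by
  have := aux_eNorm_sq x
  rw [h] at this
  exact dotProduct_self_eq_zero.1 (by simpa using this.symm)

/-- Operator norm bound. -/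
theorem aux_opNorm {n k : ℕ} (M : Matrix (Fin n) (Fin k) ℝ) (x : Fin k → ℝ) :
    eNorm (M.mulVec x) ≤ opNorm M * eNorm x := by
  have hne : {c : ℝ | 0 ≤ c ∧ ∀ x : Fin k → ℝ, eNorm (M.mulVec x) ≤ c * eNorm x}.Nonempty := by
    refine ⟨Real.sqrt (∑ i, ∑ j, M i j ^ 2), Real.sqrt_nonneg _, fun x => ?_⟩
    rw [eNorm, eNorm, ← Real.sqrt_mul (by positivity)]
    apply Real.sqrt_le_sqrt
    rw [Finset.sum_mul]
    exact Finset.sum_le_sum fun i _ =>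
      Finset.sum_mul_sq_le_sq_mul_sq Finset.univ (fun j => M i j) x
  rcases (aux_eNorm_nonneg x).eq_or_lt with h | h
  · obtain ⟨c, hc0, hc⟩ := hne
    have := hc x
    rw [← h] at this ⊢
    simpa using this
  · rw [← div_le_iff₀ h]
    refine le_csInf hne fun c hc => ?_
    rw [div_le_iff₀ h]
    exact hc.2 x

theorem aux_opNorm_nonneg {n k : ℕ} (M : Matrix (Fin n) (Fin k) ℝ) : 0 ≤ opNorm M :=
  Real.sInf_nonneg fun _ hc => hc.1

theorem aux_minEig {n : ℕ} (hn : 0 < n) {A : Matrix (Fin n) (Fin n) ℝ} (hA : A.PosDef) :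
    0 < minEig A ∧ ∀ x : Fin n → ℝ, minEig A * (x ⬝ᵥ x) ≤ x ⬝ᵥ (A *ᵥ x) := by
  have hcont : Continuous fun x : Fin n → ℝ => eNorm x := by unfold eNorm; fun_prop
  have hcomp : IsCompact {x : Fin n → ℝ | eNorm x = 1} := by
    refine Metric.isCompact_of_isClosed_isBounded (isClosed_eq hcont continuous_const) ?_
    refine (Metric.isBounded_closedBall (x := (0 : Fin n → ℝ)) (r := 1)).subset fun x hx => ?_
    rw [mem_closedBall_zero_iff, pi_norm_le_iff_of_nonneg zero_le_one]
    intro i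
    have hx' : eNorm x = 1 := hx
    have h1 : x i ^ 2 ≤ ∑ j, x j ^ 2 :=
      Finset.single_le_sum (f := fun j => x j ^ 2) (fun j _ => sq_nonneg _) (Finset.mem_univ i)
    rw [eNorm, Real.sqrt_eq_one] at hx'
    rw [Real.norm_eq_abs, ← sq_le_one_iff_abs_le_one]
    linarith
  have hne : {x : Fin n → ℝ | eNorm x = 1}.Nonempty := by
    refine ⟨Pi.single ⟨0, hn⟩ 1, ?_⟩
    simp [eNorm, Pi.single_apply]
  have hc2 : Continuous fun x : Fin n → ℝ => x ⬝ᵥ (A *ᵥ x) := by fun_prop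
  obtain ⟨x0, hx0, hmin⟩ := hcomp.exists_isMinOn hne hc2.continuousOn
  have hleast : IsLeast {r : ℝ | ∃ x : Fin n → ℝ, eNorm x = 1 ∧ r = x ⬝ᵥ A.mulVec x}
      (x0 ⬝ᵥ (A *ᵥ x0)) := by
    refine ⟨⟨x0, hx0, rfl⟩, ?_⟩
    rintro r ⟨x, hx, rfl⟩
    exact hmin hx
  have heq : minEig A = x0 ⬝ᵥ (A *ᵥ x0) := hleast.csInf_eq
  have hx0' : eNorm x0 = 1 := hx0
  constructor
  · rw [heq]
    have : x0 ≠ 0 := by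
      rintro rfl
      simp [eNorm] at hx0'
    simpa using hA.dotProduct_mulVec_pos this
  · intro x
    rcases (aux_eNorm_nonneg x).eq_or_lt with h | h
    · rw [aux_eNorm_eq_zero x h.symm]; simp
    · have h1 : eNorm ((eNorm x)⁻¹ • x) = 1 := by
        rw [aux_eNorm_smul _ (by positivity)]; field_simp
      have h2 := hleast.2 ⟨_, h1, rfl⟩
      rw [heq, ← aux_eNorm_sq]
      simp only [Matrix.mulVec_smul, smul_dotProduct, dotProduct_smul, smul_eq_mul] at h2
      rw [← mul_assoc, ← mul_inv, ← sq, inv_mul_eq_div, le_div_iff₀ (by positivity)] at h2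
      exact h2

/-- `x^T A⁻¹ x ≤ |x|²/l` when `A ≥ l`. -/
theorem aux_inv_le {n : ℕ} {A : Matrix (Fin n) (Fin n) ℝ} (hA : A.PosDef) (l : ℝ) (hl : 0 < l)
    (h : ∀ x : Fin n → ℝ, l * (x ⬝ᵥ x) ≤ x ⬝ᵥ (A *ᵥ x)) (x : Fin n → ℝ) :
    x ⬝ᵥ (A⁻¹ *ᵥ x) ≤ l⁻¹ * (x ⬝ᵥ x) := by
  set z := A⁻¹ *ᵥ x with hz
  have hAz : A *ᵥ z = x := aux_inv_mulVec hA x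
  have h1 := h z
  rw [hAz] at h1
  have h2 : 0 ≤ (x - l • z) ⬝ᵥ (x - l • z) := by
    rw [← aux_eNorm_sq]; positivity
  simp only [sub_dotProduct, dotProduct_sub, smul_dotProduct, dotProduct_smul, smul_eq_mul] at h2
  rw [dotProduct_comm z x] at h1 h2
  rw [inv_mul_eq_div, le_div_iff₀ hl]
  nlinarith

theorem aux_Pbound {n k : ℕ} {A : Matrix (Fin n) (Fin n) ℝ} (Z : Matrix (Fin n) (Fin k) ℝ)
    (hA : A.PosDef) (l : ℝ) (hl : 0 < l)
    (h : ∀ x : Fin n → ℝ, l * (x ⬝ᵥ x) ≤ x ⬝ᵥ (A *ᵥ x)) :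
    (Zᵀ * A⁻¹ * Z).PosSemidef ∧
    ((l⁻¹ * opNorm Z ^ 2) • (1 : Matrix (Fin k) (Fin k) ℝ) - Zᵀ * A⁻¹ * Z).PosSemidef := by
  have h0 : (Zᵀ * A⁻¹ * Z).PosSemidef := by
    have := hA.inv.posSemidef.conjTranspose_mul_mul_same Z
    rwa [Matrix.conjTranspose_eq_transpose_of_trivial] at this
  refine ⟨h0, Matrix.PosSemidef.of_dotProduct_mulVec_nonneg ?_ fun x => ?_⟩
  · refine Matrix.IsHermitian.sub ?_ h0.isHermitian
    rw [Matrix.IsHermitian]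
    simp
  · have h1 := aux_inv_le hA l hl h (Z *ᵥ x)
    have h2 := aux_opNorm Z x
    have h3 : eNorm (Z *ᵥ x) ^ 2 ≤ (opNorm Z * eNorm x) ^ 2 :=
      pow_le_pow_left₀ (aux_eNorm_nonneg _) h2 2
    rw [mul_pow, aux_eNorm_sq, aux_eNorm_sq] at h3
    have h4 : x ⬝ᵥ ((Zᵀ * A⁻¹ * Z) *ᵥ x) = (Z *ᵥ x) ⬝ᵥ (A⁻¹ *ᵥ (Z *ᵥ x)) := by
      rw [← Matrix.mulVec_mulVec, ← Matrix.mulVec_mulVec, Matrix.dotProduct_mulVec,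
        Matrix.vecMul_transpose]
    have h5 : l⁻¹ * ((Z *ᵥ x) ⬝ᵥ (Z *ᵥ x)) ≤ l⁻¹ * (opNorm Z ^ 2 * (x ⬝ᵥ x)) :=
      mul_le_mul_of_nonneg_left h3 (by positivity)
    rw [star_trivial, Matrix.sub_mulVec, dotProduct_sub, h4, Matrix.smul_mulVec, Matrix.one_mulVec,
      dotProduct_smul, smul_eq_mul]
    linarith

namespace LMEData

variable {m p q : ℕ}

theorem aux_Omega_psd (D : LMEData m p q) (γ : Vec q) (hγ : ∀ j, 0 ≤ γ j) (i : Fin m) :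
    (D.Z i * diagonal γ * (D.Z i)ᵀ).PosSemidef := by
  have h : (diagonal γ).PosSemidef := Matrix.posSemidef_diagonal_iff.2 hγ
  have := h.mul_mul_conjTranspose_same (D.Z i)
  rwa [Matrix.conjTranspose_eq_transpose_of_trivial] at this

theorem aux_Omega_pd (D : LMEData m p q) (hlam : ∀ i, (D.lam i).PosDef) (γ : Vec q)
    (hγ : ∀ j, 0 ≤ γ j) (i : Fin m) : (D.Omega (diagonal γ) i).PosDef :=
  Matrix.PosDef.posSemidef_add (D.aux_Omega_psd γ hγ i) (hlam i)

theorem aux_Omega_ge (D : LMEData m p q) (hn : ∀ i, 0 < D.n i) (hlam : ∀ i, (D.lam i).PosDef)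
    (γ : Vec q) (hγ : ∀ j, 0 ≤ γ j) (i : Fin m) (x : Fin (D.n i) → ℝ) :
    minEig (D.lam i) * (x ⬝ᵥ x) ≤ x ⬝ᵥ (D.Omega (diagonal γ) i *ᵥ x) := by
  have h1 := (aux_minEig (hn i) (hlam i)).2 x
  have h2 := (D.aux_Omega_psd γ hγ i).dotProduct_mulVec_nonneg x
  rw [star_trivial] at h2
  rw [Omega, Matrix.add_mulVec, dotProduct_add]
  linarith

theorem aux_Omega_comb (D : LMEData m p q) (γ γ' : Vec q) (a b : ℝ) (hab : a + b = 1) (i : Fin m) :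
    D.Omega (diagonal (a • γ + b • γ')) i
      = a • D.Omega (diagonal γ) i + b • D.Omega (diagonal γ') i := by
  have h1 : diagonal (a • γ + b • γ') = a • diagonal γ + b • diagonal γ' := by
    rw [← Matrix.diagonal_smul, ← Matrix.diagonal_smul, Matrix.diagonal_add]; rfl
  have h2 : D.lam i = a • D.lam i + b • D.lam i := by rw [← add_smul, hab, one_smul]
  simp only [Omega]
  conv_lhs => rw [h2]
  rw [h1, Matrix.mul_add, Matrix.add_mul]
  simp only [Matrix.mul_smul, Matrix.smul_mul, smul_add]
  abel

theorem aux_Omega_sub (D : LMEData m p q) (γ γ' : Vec q) (i : Fin m) :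
    D.Omega (diagonal γ') i - D.Omega (diagonal γ) i
      = D.Z i * diagonal (γ' - γ) * (D.Z i)ᵀ := by
  have h1 : diagonal (γ' - γ) = diagonal γ' - diagonal γ := by rw [Matrix.diagonal_sub]; rfl
  rw [h1, Matrix.mul_sub, Matrix.sub_mul, Omega, Omega]
  abel

/-- the term inside `nu` -/
def nuI (D : LMEData m p q) (i : Fin m) : ℝ :=
  (1 : ℝ) / 2 * ((minEig (D.lam i)) ^ 2)⁻¹ * (opNorm (D.Z i)) ^ 4

theorem aux_nuI_nonneg (D : LMEData m p q) (i : Fin m) : 0 ≤ D.nuI i := by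
  unfold nuI
  have := aux_opNorm_nonneg (D.Z i)
  positivity

theorem aux_nuI_le (D : LMEData m p q) (i : Fin m) : D.nuI i ≤ D.nu :=
  le_ciSup (f := fun i => D.nuI i) (Set.finite_range _).bddAbove i

theorem aux_etabar_nonneg (D : LMEData m p q) (hm : 0 < m) : 0 ≤ D.etabar :=
  mul_nonneg ((D.aux_nuI_nonneg ⟨0, hm⟩).trans (D.aux_nuI_le _)) (Nat.cast_nonneg _)

theorem aux_sum_nuI (D : LMEData m p q) : ∑ i, D.nuI i ≤ D.etabar := by
  calc ∑ i, D.nuI i ≤ ∑ _i : Fin m, D.nu := Finset.sum_le_sum fun i _ => D.aux_nuI_le i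
    _ = D.etabar := by simp [etabar, mul_comm]

theorem aux_trace_mono (D : LMEData m p q) (hn : ∀ i, 0 < D.n i) (hlam : ∀ i, (D.lam i).PosDef)
    (γ γ' : Vec q) (hγ : ∀ j, 0 ≤ γ j) (hγ' : ∀ j, 0 ≤ γ' j) (i : Fin m) :
    (1 : ℝ) / 2 * ((D.Omega (diagonal γ) i)⁻¹ *
        (D.Omega (diagonal γ') i - D.Omega (diagonal γ) i)).trace
      + (1 : ℝ) / 2 * ((D.Omega (diagonal γ') i)⁻¹ *
        (D.Omega (diagonal γ) i - D.Omega (diagonal γ') i)).trace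
      ≤ D.nuI i * ∑ j, (γ' j - γ j) ^ 2 := by
  have hA := D.aux_Omega_pd hlam γ hγ i
  have hB := D.aux_Omega_pd hlam γ' hγ' i
  obtain ⟨hl, -⟩ := aux_minEig (hn i) (hlam i)
  have hP := aux_Pbound (D.Z i) hA _ hl (D.aux_Omega_ge hn hlam γ hγ i)
  have hQ := aux_Pbound (D.Z i) hB _ hl (D.aux_Omega_ge hn hlam γ' hγ' i)
  have hb := aux_trace_bound _ (by positivity) hP.2 hQ.1 hQ.2 (γ' - γ)
  have hsub := D.aux_Omega_sub γ γ' i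
  have hres := aux_resolvent hA hB
  set A := D.Omega (diagonal γ) i
  set B := D.Omega (diagonal γ') i
  have e1 : (A⁻¹ * (B - A)).trace + (B⁻¹ * (A - B)).trace
      = ((D.Z i)ᵀ * A⁻¹ * D.Z i * (diagonal (γ' - γ) * ((D.Z i)ᵀ * B⁻¹ * D.Z i)
          * diagonal (γ' - γ))).trace := by
    have : A⁻¹ * (B - A) + B⁻¹ * (A - B) = (A⁻¹ - B⁻¹) * (B - A) := by
      rw [← neg_sub B A]; noncomm_ring
    rw [← Matrix.trace_add, this, hres, hsub, ← Matrix.mul_assoc, Matrix.trace_mul_comm]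
    simp only [Matrix.mul_assoc]
  rw [← e1] at hb
  simp only [Pi.sub_apply] at hb
  have e2 : D.nuI i = 1 / 2 * ((minEig (D.lam i))⁻¹ * opNorm (D.Z i) ^ 2) ^ 2 := by
    unfold nuI; rw [mul_pow, inv_pow]; ring
  rw [e2]
  linarith

/-- quadratic part of `L` -/
def Qf (D : LMEData m p q) (x : Vec p × Vec q) (i : Fin m) : ℝ :=
  (D.y i - D.X i *ᵥ x.1) ⬝ᵥ ((D.Omega (diagonal x.2) i)⁻¹ *ᵥ (D.y i - D.X i *ᵥ x.1))

/-- directional derivative of log det -/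
def Tf (D : LMEData m p q) (γ γ' : Vec q) (i : Fin m) : ℝ :=
  ((D.Omega (diagonal γ) i)⁻¹ * (D.Omega (diagonal γ') i - D.Omega (diagonal γ) i)).trace

theorem aux_L_le (D : LMEData m p q) (hlam : ∀ i, (D.lam i).PosDef)
    (x x' : Vec p × Vec q) (hx : ∀ j, 0 ≤ x.2 j) (hx' : ∀ j, 0 ≤ x'.2 j)
    (a b : ℝ) (ha : 0 ≤ a) (hb : 0 ≤ b) (hab : a + b = 1) :
    D.L (a • x.1 + b • x'.1) (a • x.2 + b • x'.2) ≤ D.L x.1 x.2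
      + b * ∑ i, ((1 : ℝ) / 2 * (D.Qf x' i - D.Qf x i) + (1 : ℝ) / 2 * D.Tf x.2 x'.2 i) := by
  rw [L, L, LML, LML, Finset.mul_sum, ← Finset.sum_add_distrib]
  refine Finset.sum_le_sum fun i _ => ?_
  have hA := D.aux_Omega_pd hlam x.2 hx i
  have hB := D.aux_Omega_pd hlam x'.2 hx' i
  have hM := D.aux_Omega_pd hlam (a • x.2 + b • x'.2) (fun j => by
    have := mul_nonneg ha (hx j)
    have := mul_nonneg hb (hx' j)
    simp only [Pi.add_apply, Pi.smul_apply, smul_eq_mul]; linarith) i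
  rw [D.aux_Omega_comb x.2 x'.2 a b hab i] at hM ⊢
  have hr : D.y i - D.X i *ᵥ (a • x.1 + b • x'.1)
      = a • (D.y i - D.X i *ᵥ x.1) + b • (D.y i - D.X i *ᵥ x'.1) := by
    rw [Matrix.mulVec_add, Matrix.mulVec_smul, Matrix.mulVec_smul, smul_sub, smul_sub]
    have h2 : D.y i = a • D.y i + b • D.y i := by rw [← add_smul, hab, one_smul]
    conv_lhs => rw [h2]
    abel
  have h1 := aux_quad_convex hA hB (D.y i - D.X i *ᵥ x.1) (D.y i - D.X i *ᵥ x'.1) a b ha hb hM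
  rw [← hr] at h1
  have h2 := aux_logdet hA hM
  have h3 : a • D.Omega (diagonal x.2) i + b • D.Omega (diagonal x'.2) i - D.Omega (diagonal x.2) i
      = b • (D.Omega (diagonal x'.2) i - D.Omega (diagonal x.2) i) := by
    have : a = 1 - b := by linarith
    rw [this, sub_smul, one_smul, smul_sub]; abel
  rw [h3, Matrix.mul_smul, Matrix.trace_smul, smul_eq_mul] at h2
  have ea : a = 1 - b := by linarith
  rw [ea] at h1
  simp only [Qf, Tf]
  rw [ea] at h2 ⊢
  linarith

end LMEData

/-- effective domain of the barrier -/
def phiDom (μ : ℝ) {q : ℕ} (γ : Vec q) : Prop := ∀ j, 0 ≤ γ j ∧ (μ ≠ 0 → 0 < γ j)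

/-- real-valued barrier -/
def phiR (μ : ℝ) {q : ℕ} (γ : Vec q) : ℝ := (-μ) * ∑ j, Real.log (γ j / μ)

theorem phiBar_of_dom {μ : ℝ} (hμ : 0 ≤ μ) {q : ℕ} {γ : Vec q} (h : phiDom μ γ) :
    phiBar μ γ = ((phiR μ γ : ℝ) : EReal) := by
  unfold phiBar phiR
  rcases hμ.eq_or_lt with h0 | h0
  · subst h0
    rw [if_pos rfl, if_pos fun j => (h j).1]; simp
  · rw [if_neg h0.ne', if_pos h0, if_pos fun j => (h j).2 h0.ne']

theorem phiBar_of_not_dom {μ : ℝ} (hμ : 0 ≤ μ) {q : ℕ} {γ : Vec q} (h : ¬ phiDom μ γ) :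
    phiBar μ γ = ⊤ := by
  unfold phiBar
  rcases hμ.eq_or_lt with h0 | h0
  · subst h0
    rw [if_pos rfl, if_neg fun h' => h fun j => ⟨h' j, fun h => absurd rfl h⟩]
  · rw [if_neg h0.ne', if_pos h0, if_neg fun h' => h fun j => ⟨(h' j).le, fun _ => h' j⟩]

theorem phiDom_comb {μ : ℝ} {q : ℕ} {γ γ' : Vec q} (h : phiDom μ γ) (h' : phiDom μ γ')
    (a b : ℝ) (ha : 0 ≤ a) (hb : 0 ≤ b) (hab : a + b = 1) : phiDom μ (a • γ + b • γ') := by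
  intro j
  refine ⟨?_, fun h0 => ?_⟩
  · exact (convex_Ici (0 : ℝ)) (h j).1 (h' j).1 ha hb hab
  · exact (convex_Ioi (0 : ℝ)) ((h j).2 h0) ((h' j).2 h0) ha hb hab

theorem phiR_comb {μ : ℝ} (hμ : 0 ≤ μ) {q : ℕ} {γ γ' : Vec q} (h : phiDom μ γ)
    (h' : phiDom μ γ') (a b : ℝ) (ha : 0 ≤ a) (hb : 0 ≤ b) (hab : a + b = 1) :
    phiR μ (a • γ + b • γ') ≤ a * phiR μ γ + b * phiR μ γ' := by
  rcases hμ.eq_or_lt with h0 | h0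
  · subst h0; simp [phiR]
  · have key : a * ∑ j, Real.log (γ j / μ) + b * ∑ j, Real.log (γ' j / μ)
        ≤ ∑ j, Real.log ((a • γ + b • γ') j / μ) := by
      rw [Finset.mul_sum, Finset.mul_sum, ← Finset.sum_add_distrib]
      refine Finset.sum_le_sum fun j _ => ?_
      have := strictConcaveOn_log_Ioi.concaveOn.2 (x := γ j / μ) (y := γ' j / μ)
        (div_pos ((h j).2 h0.ne') h0) (div_pos ((h' j).2 h0.ne') h0) ha hb hab
      simp only [smul_eq_mul, Pi.add_apply, Pi.smul_apply] at this ⊢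
      rwa [add_div, mul_div_assoc, mul_div_assoc]
    unfold phiR
    nlinarith

/-- inner product on pairs -/
def ipp {p q : ℕ} (a b : Vec p × Vec q) : ℝ := a.1 ⬝ᵥ b.1 + a.2 ⬝ᵥ b.2

theorem sqnorm2_eq {p q : ℕ} (a : Vec p × Vec q) : sqnorm2 a = ipp a a := by
  simp [sqnorm2, ipp, dotProduct, sq]

theorem sqnorm2_nonneg {p q : ℕ} (a : Vec p × Vec q) : 0 ≤ sqnorm2 a := by
  unfold sqnorm2; positivity

theorem ipp_comm {p q : ℕ} (a b : Vec p × Vec q) : ipp a b = ipp b a := by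
  simp [ipp, dotProduct_comm]

theorem ipp_add_left {p q : ℕ} (a b c : Vec p × Vec q) : ipp (a + b) c = ipp a c + ipp b c := by
  simp [ipp, add_dotProduct]; ring

theorem ipp_sub_left {p q : ℕ} (a b c : Vec p × Vec q) : ipp (a - b) c = ipp a c - ipp b c := by
  simp [ipp, sub_dotProduct]; ring

theorem ipp_sub_right {p q : ℕ} (a b c : Vec p × Vec q) : ipp a (b - c) = ipp a b - ipp a c := by
  simp [ipp, dotProduct_sub]; ring

theorem ipp_smul_left {p q : ℕ} (t : ℝ) (a c : Vec p × Vec q) : ipp (t • a) c = t * ipp a c := by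
  simp [ipp]; ring

theorem ipp_add_right {p q : ℕ} (a b c : Vec p × Vec q) : ipp a (b + c) = ipp a b + ipp a c := by
  simp [ipp, dotProduct_add]; ring

theorem ipp_smul_right {p q : ℕ} (t : ℝ) (a c : Vec p × Vec q) : ipp a (t • c) = t * ipp a c := by
  simp [ipp]; ring

theorem aux_limit (K E : ℝ) (h : ∀ t : ℝ, 0 < t → t ≤ 1 → 0 ≤ t * K + t ^ 2 * E) : 0 ≤ K := by
  by_contra! hK
  have hpos : 0 < |E| - K + 1 := by have := abs_nonneg E; linarith
  set t := -K / (|E| - K + 1) with ht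
  have ht0 : 0 < t := div_pos (by linarith) hpos
  have ht1 : t ≤ 1 := by rw [ht, div_le_one hpos]; have := abs_nonneg E; linarith
  have h1 := h t ht0 ht1
  have h2 : 0 ≤ K + t * E := by
    by_contra! h3
    nlinarith
  have h4 : t * (|E| - K + 1) = -K := by rw [ht]; field_simp
  have h5 : t * E ≤ t * |E| := mul_le_mul_of_nonneg_left (le_abs_self E) ht0.le
  nlinarith

namespace LMEData

variable {m p q : ℕ}

/-- real-valued objective -/
def Fr (D : LMEData m p q) (η μ : ℝ) (x w : Vec p × Vec q) : ℝ :=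
  D.L x.1 x.2 + kappaFun η (x - w) + phiR μ x.2

theorem Lrelax_of_dom (D : LMEData m p q) (η : ℝ) {μ : ℝ} (hμ : 0 ≤ μ) (x w : Vec p × Vec q)
    (h : phiDom μ x.2) : D.Lrelax η μ x w = ((D.Fr η μ x w : ℝ) : EReal) := by
  rw [Lrelax, phiBar_of_dom hμ h, Fr, ← EReal.coe_add]

theorem Lrelax_of_not_dom (D : LMEData m p q) (η : ℝ) {μ : ℝ} (hμ : 0 ≤ μ) (x w : Vec p × Vec q)
    (h : ¬ phiDom μ x.2) : D.Lrelax η μ x w = ⊤ := by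
  rw [Lrelax, phiBar_of_not_dom hμ h, EReal.coe_add_top]

theorem S_dom (D : LMEData m p q) (η : ℝ) {μ : ℝ} (hμ : 0 ≤ μ)
    (S : Vec p × Vec q → Vec p × Vec q)
    (hS : ∀ w x' : Vec p × Vec q, D.Lrelax η μ (S w) w ≤ D.Lrelax η μ x' w) (w : Vec p × Vec q) :
    phiDom μ (S w).2 := by
  by_contra h
  have h1 := hS w (0, fun _ => 1)
  rw [D.Lrelax_of_not_dom η hμ _ _ h, D.Lrelax_of_dom η hμ (0, fun _ => 1) w
    (fun j => ⟨zero_le_one, fun _ => zero_lt_one⟩)] at h1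
  exact absurd (top_le_iff.1 h1) (EReal.coe_ne_top _)

theorem S_min (D : LMEData m p q) (η : ℝ) {μ : ℝ} (hμ : 0 ≤ μ)
    (S : Vec p × Vec q → Vec p × Vec q)
    (hS : ∀ w x' : Vec p × Vec q, D.Lrelax η μ (S w) w ≤ D.Lrelax η μ x' w)
    (w x' : Vec p × Vec q) (hx' : phiDom μ x'.2) : D.Fr η μ (S w) w ≤ D.Fr η μ x' w := by
  have h := hS w x'
  rw [D.Lrelax_of_dom η hμ _ _ (D.S_dom η hμ S hS w), D.Lrelax_of_dom η hμ _ _ hx'] at h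
  exact_mod_cast h

theorem ufun_eq (D : LMEData m p q) (η : ℝ) {μ : ℝ} (hμ : 0 ≤ μ)
    (S : Vec p × Vec q → Vec p × Vec q)
    (hS : ∀ w x' : Vec p × Vec q, D.Lrelax η μ (S w) w ≤ D.Lrelax η μ x' w)
    (w : Vec p × Vec q) : D.ufun η μ w = D.Fr η μ (S w) w := by
  have : D.uval η μ w = D.Lrelax η μ (S w) w :=
    le_antisymm (iInf_le _ _) (le_iInf fun x => hS w x)
  rw [ufun, this, D.Lrelax_of_dom η hμ _ _ (D.S_dom η hμ S hS w), EReal.toReal_coe]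

theorem S_vi (D : LMEData m p q) (hlam : ∀ i, (D.lam i).PosDef) (η : ℝ) {μ : ℝ} (hμ : 0 ≤ μ)
    (S : Vec p × Vec q → Vec p × Vec q)
    (hS : ∀ w x' : Vec p × Vec q, D.Lrelax η μ (S w) w ≤ D.Lrelax η μ x' w)
    (w x' : Vec p × Vec q) (hx' : phiDom μ x'.2) :
    0 ≤ ∑ i, ((1 : ℝ) / 2 * (D.Qf x' i - D.Qf (S w) i) + (1 : ℝ) / 2 * D.Tf (S w).2 x'.2 i)
      + (phiR μ x'.2 - phiR μ (S w).2) + η * ipp (S w - w) (x' - S w) := by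
  have hd := D.S_dom η hμ S hS w
  have hm := D.S_min η hμ S hS w
  set x := S w with hx
  refine aux_limit _ (η / 2 * sqnorm2 (x' - x)) fun t ht0 ht1 => ?_
  have ha : (0 : ℝ) ≤ 1 - t := by linarith
  have hab : (1 - t) + t = 1 := by ring
  have h1 := hm ((1 - t) • x + t • x') (phiDom_comb hd hx' _ _ ha ht0.le hab)
  have h2 := D.aux_L_le hlam x x' (fun j => (hd j).1) (fun j => (hx' j).1) (1 - t) t ha ht0.le hab
  have h3 := phiR_comb hμ hd hx' (1 - t) t ha ht0.le hab
  have h4 : kappaFun η ((1 - t) • x + t • x' - w) = kappaFun η (x - w)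
      + t * (η * ipp (x - w) (x' - x)) + t ^ 2 * (η / 2 * sqnorm2 (x' - x)) := by
    have e : (1 - t) • x + t • x' - w = (x - w) + t • (x' - x) := by
      rw [sub_smul, one_smul, smul_sub]; abel
    rw [kappaFun, kappaFun, e, sqnorm2_eq, sqnorm2_eq, sqnorm2_eq, ipp_add_left, ipp_add_right,
      ipp_add_right, ipp_smul_left, ipp_smul_right, ipp_smul_left, ipp_smul_right,
      ipp_comm (x' - x) (x - w)]
    ring
  simp only [Fr, Prod.fst_add, Prod.snd_add, Prod.smul_fst, Prod.smul_snd] at h1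
  rw [h4] at h1
  linarith

theorem S_mono (D : LMEData m p q) (hm : 0 < m) (hn : ∀ i, 0 < D.n i)
    (hlam : ∀ i, (D.lam i).PosDef) (η : ℝ) {μ : ℝ} (hμ : 0 ≤ μ)
    (S : Vec p × Vec q → Vec p × Vec q)
    (hS : ∀ w x' : Vec p × Vec q, D.Lrelax η μ (S w) w ≤ D.Lrelax η μ x' w)
    (w w' : Vec p × Vec q) :
    (η - D.etabar) * sqnorm2 (S w' - S w) ≤ η * ipp (w' - w) (S w' - S w) := by
  have hd := D.S_dom η hμ S hS w
  have hd' := D.S_dom η hμ S hS w'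
  have h1 := D.S_vi hlam η hμ S hS w (S w') hd'
  have h2 := D.S_vi hlam η hμ S hS w' (S w) hd
  set x := S w
  set x' := S w'
  have h3 : ∑ i, ((1 : ℝ) / 2 * D.Tf x.2 x'.2 i + (1 : ℝ) / 2 * D.Tf x'.2 x.2 i)
      ≤ D.etabar * sqnorm2 (x' - x) := by
    calc _ ≤ ∑ i, D.nuI i * ∑ j, (x'.2 j - x.2 j) ^ 2 :=
          Finset.sum_le_sum fun i _ => D.aux_trace_mono hn hlam x.2 x'.2
            (fun j => (hd j).1) (fun j => (hd' j).1) i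
      _ = (∑ i, D.nuI i) * ∑ j, (x'.2 j - x.2 j) ^ 2 := by rw [Finset.sum_mul]
      _ ≤ D.etabar * ∑ j, (x'.2 j - x.2 j) ^ 2 :=
          mul_le_mul_of_nonneg_right D.aux_sum_nuI (by positivity)
      _ ≤ D.etabar * sqnorm2 (x' - x) := by
          refine mul_le_mul_of_nonneg_left ?_ (D.aux_etabar_nonneg hm)
          have : 0 ≤ ∑ j, ((x' - x).1 j) ^ 2 := by positivity
          simp only [sqnorm2, Prod.snd_sub, Pi.sub_apply] at this ⊢
          linarith
  simp only [Finset.sum_add_distrib, mul_sub, Finset.sum_sub_distrib] at h1 h2 h3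
  have e1 : sqnorm2 (x' - x) = ipp x' x' - 2 * ipp x x' + ipp x x := by
    rw [sqnorm2_eq, ipp_sub_left, ipp_sub_right, ipp_sub_right, ipp_comm x' x]; ring
  rw [e1] at h3 ⊢
  simp only [ipp_sub_left, ipp_sub_right] at h1 h2 ⊢
  rw [ipp_comm x' x] at h2
  linarith

theorem S_lip (D : LMEData m p q) (hm : 0 < m) (hn : ∀ i, 0 < D.n i)
    (hlam : ∀ i, (D.lam i).PosDef) (η : ℝ) {μ : ℝ} (hμ : 0 ≤ μ) (hη : D.etabar < η)
    (S : Vec p × Vec q → Vec p × Vec q)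
    (hS : ∀ w x' : Vec p × Vec q, D.Lrelax η μ (S w) w ≤ D.Lrelax η μ x' w)
    (w w' : Vec p × Vec q) :
    sqnorm2 (S w' - S w) ≤ (η / (η - D.etabar)) ^ 2 * sqnorm2 (w' - w) := by
  have h := D.S_mono hm hn hlam η hμ S hS w w'
  have hc : 0 < η - D.etabar := by linarith
  set c := η - D.etabar
  set k := η / c with hk
  have hk' : η = k * c := by rw [hk]; field_simp
  have h1 : 0 ≤ sqnorm2 (S w' - S w) - 2 * (k * ipp (w' - w) (S w' - S w))
      + k ^ 2 * sqnorm2 (w' - w) := by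
    have h1 := sqnorm2_nonneg ((S w' - S w) - k • (w' - w))
    generalize S w' - S w = d at h1 ⊢
    generalize w' - w = e at h1 ⊢
    rw [sqnorm2_eq, ipp_sub_left, ipp_sub_right, ipp_sub_right, ipp_smul_left, ipp_smul_right,
      ipp_smul_left, ipp_smul_right, ipp_comm d e, ← sqnorm2_eq, ← sqnorm2_eq] at h1
    linarith
  have h2 : sqnorm2 (S w' - S w) ≤ k * ipp (w' - w) (S w' - S w) := by
    rw [hk'] at h
    have : c * sqnorm2 (S w' - S w) ≤ c * (k * ipp (w' - w) (S w' - S w)) := by linarith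
    exact le_of_mul_le_mul_left this hc
  nlinarith

end LMEData

theorem sqnorm2_le_norm {p q : ℕ} (a : Vec p × Vec q) : sqnorm2 a ≤ (p + q) * ‖a‖ ^ 2 := by
  have h1 : ∑ j, (a.1 j) ^ 2 ≤ ∑ _j : Fin p, ‖a‖ ^ 2 := Finset.sum_le_sum fun j _ => by
    rw [← sq_abs]
    exact pow_le_pow_left₀ (abs_nonneg _) ((norm_le_pi_norm a.1 j).trans (norm_fst_le a)) 2
  have h2 : ∑ j, (a.2 j) ^ 2 ≤ ∑ _j : Fin q, ‖a‖ ^ 2 := Finset.sum_le_sum fun j _ => by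
    rw [← sq_abs]
    exact pow_le_pow_left₀ (abs_nonneg _) ((norm_le_pi_norm a.2 j).trans (norm_snd_le a)) 2
  simp at h1 h2
  unfold sqnorm2
  linarith

theorem norm_sq_le_sqnorm2 {p q : ℕ} (a : Vec p × Vec q) : ‖a‖ ≤ Real.sqrt (sqnorm2 a) := by
  rw [norm_prod_le_iff, pi_norm_le_iff_of_nonneg (Real.sqrt_nonneg _),
    pi_norm_le_iff_of_nonneg (Real.sqrt_nonneg _)]
  have hp : 0 ≤ ∑ j, (a.1 j) ^ 2 := by positivity
  have hq : 0 ≤ ∑ j, (a.2 j) ^ 2 := by positivity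
  constructor
  · intro i
    refine Real.abs_le_sqrt ?_
    have := Finset.single_le_sum (f := fun j => a.1 j ^ 2) (fun j _ => sq_nonneg _)
      (Finset.mem_univ i)
    unfold sqnorm2; linarith
  · intro i
    refine Real.abs_le_sqrt ?_
    have := Finset.single_le_sum (f := fun j => a.2 j ^ 2) (fun j _ => sq_nonneg _)
      (Finset.mem_univ i)
    unfold sqnorm2; linarith

/-- the linear functional `ipp v ·` as a continuous linear map -/
def ippL {p q : ℕ} (v : Vec p × Vec q) : (Vec p × Vec q) →L[ℝ] ℝ :=
  (∑ j, v.1 j • (ContinuousLinearMap.proj (R := ℝ) (φ := fun _ : Fin p => ℝ) j).comp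
      (ContinuousLinearMap.fst ℝ (Vec p) (Vec q)))
    + ∑ j, v.2 j • (ContinuousLinearMap.proj (R := ℝ) (φ := fun _ : Fin q => ℝ) j).comp
      (ContinuousLinearMap.snd ℝ (Vec p) (Vec q))

theorem ippL_apply {p q : ℕ} (v h : Vec p × Vec q) : ippL v h = ipp v h := by
  simp [ippL, ipp, dotProduct]

theorem continuous_ippL {p q : ℕ} : Continuous (ippL : Vec p × Vec q → _) := by
  unfold ippL
  fun_prop

/-- u_{η,μ} is continuously differentiable with
∇u_{η,μ}(β̃,γ̃) = η·(β̃ − β̂, γ̃ − γ̂), where (β̂,γ̂) = S_{η,μ}(β̃,γ̃). -/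
theorem value_function_differentiable
    {m p q : ℕ} (hm : 0 < m) (hp : 0 < p) (hq : 0 < q)
    (D : LMEData m p q) (hn : ∀ i, 0 < D.n i) (hlam : ∀ i, (D.lam i).PosDef)
    (μ η : ℝ) (hμ : 0 ≤ μ) (hη : D.etabar < η)
    (S : Vec p × Vec q → Vec p × Vec q)
    (hS : ∀ w x' : Vec p × Vec q, D.Lrelax η μ (S w) w ≤ D.Lrelax η μ x' w) :
    ContDiff ℝ 1 (D.ufun η μ) ∧
    ∀ w dw : Vec p × Vec q,
      fderiv ℝ (D.ufun η μ) w dw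
        = η * ((w.1 - (S w).1) ⬝ᵥ dw.1 + (w.2 - (S w).2) ⬝ᵥ dw.2) := by
  have hη0 : 0 ≤ η := (D.aux_etabar_nonneg hm).trans hη.le
  set k := η / (η - D.etabar) with hk
  have hlip := D.S_lip hm hn hlam η hμ hη S hS
  -- continuity of S
  have hScont : Continuous S := by
    have hsq : Continuous (sqnorm2 : Vec p × Vec q → ℝ) := by unfold sqnorm2; fun_prop
    rw [continuous_iff_continuousAt]
    intro w
    rw [ContinuousAt, tendsto_iff_norm_sub_tendsto_zero]
    refine squeeze_zero (fun _ => norm_nonneg _) (fun w' => (norm_sq_le_sqnorm2 _).trans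
      (Real.sqrt_le_sqrt (hlip w w'))) ?_
    have : Continuous fun w' => Real.sqrt (k ^ 2 * sqnorm2 (w' - w)) := by fun_prop
    have h0 := this.tendsto w
    simpa [sqnorm2] using h0
  -- one-sided estimate
  have hup : ∀ w w' : Vec p × Vec q, D.ufun η μ w' - D.ufun η μ w
      ≤ η * ipp (w - S w) (w' - w) + η / 2 * sqnorm2 (w' - w) := by
    intro w w'
    rw [D.ufun_eq η hμ S hS, D.ufun_eq η hμ S hS]
    have h1 := D.S_min η hμ S hS w' (S w) (D.S_dom η hμ S hS w)
    have h2 : kappaFun η (S w - w') = kappaFun η (S w - w)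
        + η * ipp (w - S w) (w' - w) + η / 2 * sqnorm2 (w' - w) := by
      simp only [kappaFun, sqnorm2_eq, ipp_sub_left, ipp_sub_right]
      rw [ipp_comm w' (S w), ipp_comm w (S w), ipp_comm w' w]
      ring
    simp only [LMEData.Fr] at h1 ⊢
    linarith
  have hderiv : ∀ w, HasFDerivAt (D.ufun η μ) (η • ippL (w - S w)) w := by
    intro w
    have key : ∀ w', |D.ufun η μ w' - D.ufun η μ w - η * ipp (w - S w) (w' - w)|
        ≤ (η * (k ^ 2 + 2) * (p + q)) * ‖w' - w‖ ^ 2 := by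
      intro w'
      have h1 := hup w w'
      have h2 := hup w' w
      have h3 := hlip w w'
      have h4 := sqnorm2_le_norm (w' - w)
      have h5 := sqnorm2_nonneg (w' - w)
      have e1 : sqnorm2 (w - w') = sqnorm2 (w' - w) := by
        simp only [sqnorm2_eq, ipp_sub_left, ipp_sub_right]; ring
      have e2 : ipp (w' - S w') (w - w') = - ipp (w - S w) (w' - w) - sqnorm2 (w' - w)
          + ipp (S w' - S w) (w' - w) := by
        simp only [sqnorm2_eq, ipp_sub_left, ipp_sub_right]; ring
      have h6 := sqnorm2_nonneg ((S w' - S w) - (w' - w))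
      rw [sqnorm2_eq, ipp_sub_left _ _ ((S w' - S w) - (w' - w)),
        ipp_sub_right (S w' - S w) (S w' - S w) (w' - w),
        ipp_sub_right (w' - w) (S w' - S w) (w' - w), ipp_comm (w' - w) (S w' - S w),
        ← sqnorm2_eq, ← sqnorm2_eq] at h6
      rw [e1, e2] at h2
      have h7 : ipp (S w' - S w) (w' - w) ≤ (k ^ 2 + 1) * sqnorm2 (w' - w) := by
        nlinarith [sq_nonneg k]
      have h8 : η * ipp (S w' - S w) (w' - w) ≤ η * ((k ^ 2 + 1) * sqnorm2 (w' - w)) :=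
        mul_le_mul_of_nonneg_left h7 hη0
      have h9 : 0 ≤ η * sqnorm2 (w' - w) := mul_nonneg hη0 h5
      have h9' : 0 ≤ η * k ^ 2 * sqnorm2 (w' - w) :=
        mul_nonneg (mul_nonneg hη0 (sq_nonneg k)) h5
      have h10 : η * (k ^ 2 + 2) * sqnorm2 (w' - w)
          ≤ η * (k ^ 2 + 2) * ((p + q) * ‖w' - w‖ ^ 2) :=
        mul_le_mul_of_nonneg_left h4 (by positivity)
      rw [abs_le]
      constructor <;> linarith
    have hO : (fun w' => D.ufun η μ w' - D.ufun η μ w - η * ipp (w - S w) (w' - w))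
        =O[𝓝 w] fun w' => ‖w' - w‖ ^ 2 := by
      refine Asymptotics.IsBigO.of_bound (η * (k ^ 2 + 2) * (p + q)) (Eventually.of_forall ?_)
      intro w'
      rw [Real.norm_eq_abs, Real.norm_eq_abs, abs_of_nonneg (sq_nonneg ‖w' - w‖)]
      exact key w'
    have h0 := hO.hasFDerivAt (𝕜 := ℝ) one_lt_two
    have hl : HasFDerivAt (fun w' => D.ufun η μ w + (η • ippL (w - S w)) (w' - w))
        (η • ippL (w - S w)) w := by
      simp only [map_sub]
      exact ((η • ippL (w - S w)).hasFDerivAt.sub_const _).const_add _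
    have hs := h0.add hl
    rw [zero_add] at hs
    refine hs.congr_of_eventuallyEq (Eventually.of_forall fun w' => ?_)
    simp [ippL_apply]
  have hfd : fderiv ℝ (D.ufun η μ) = fun w => η • ippL (w - S w) :=
    funext fun w => (hderiv w).fderiv
  refine ⟨contDiff_one_iff_fderiv.2 ⟨fun w => (hderiv w).differentiableAt, ?_⟩, fun w dw => ?_⟩
  · rw [hfd]
    exact (continuous_ippL.comp (continuous_id.sub hScont)).const_smul η
  · rw [hfd]
    simp [ippL_apply, ipp]
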